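/- Let h₁, h₂ define bisectors with no common slice (no complex projective line is contained in B_{h₁} ∩ B_{h₂}) and suppose D := B_{h₁} ∩ B_{h₂} ∩ 𝔹 is nonempty. Let U ⊆ V be an open set such that D' := {v ∈ U | ⟨v,v⟩ < 0, ⟨h₁v,v⟩ = 0, ⟨h₂v,v⟩ = 0} is nonempty. If h₃ and h₄ define bisectors, each distinct (as subsets of ℙ(V)) from B_{h₁} and from B_{h₂}, such that ⟨h₃v,v⟩ = 0 and ⟨h₄v,v⟩ = 0 for all v ∈ D', then B_{h₃} = B_{h₄}, and moreover B_{h₁} ∩ B_{h₂} ⊆ B_{h₃}. -/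

import Mathlib

open scoped ComplexConjugate

noncomputable section

/-- `V` is `ℂ³`. -/
abbrev V3 : Type := Fin 3 → ℂ

/-- The hermitian form of signature `(2,1)`:
`⟨x,y⟩ = x₀·conj y₀ + x₁·conj y₁ − x₂·conj y₂`. -/
def herm (x y : V3) : ℂ := x 0 * conj (y 0) + x 1 * conj (y 1) - x 2 * conj (y 2)

/-- The complex projective plane `ℙ(V)`. -/
abbrev PV : Type := Projectivization ℂ V3

/-- The class `[v]` of a nonzero vector `v` in `ℙ(V)`. -/
def projMk (v : V3) (hv : v ≠ 0) : PV := Projectivization.mk ℂ v hv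

/-- A map `h` is self-adjoint (`h* = h`) w.r.t. the hermitian form. -/
def SelfAdj (h : Module.End ℂ V3) : Prop := ∀ x y : V3, herm (h x) y = herm x (h y)

/-- The set `B_h = {[v] ∈ ℙ(V) | ⟨h v, v⟩ = 0}`. -/
def Bset (h : Module.End ℂ V3) : Set PV :=
  {q | ∃ v : V3, ∃ hv : v ≠ 0, q = projMk v hv ∧ herm (h v) v = 0}

/-- `h` defines a bisector: self-adjoint, trace `0`, rank `2`, and `B_h` contains
a point other than the focus (i.e. a point `[v]` with `h v ≠ 0`). -/
def IsBisector (h : Module.End ℂ V3) : Prop :=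
  SelfAdj h ∧ LinearMap.trace ℂ V3 h = 0 ∧
    Module.finrank ℂ (LinearMap.range h) = 2 ∧ ∃ v : V3, herm (h v) v = 0 ∧ h v ≠ 0

/-- A linear family of bisectors: an `ℝ`-subspace of self-adjoint traceless
degenerate maps whose base contains a negative point. -/
def IsLinearFamily (W : Submodule ℝ (Module.End ℂ V3)) : Prop :=
  (∀ h ∈ W, SelfAdj h ∧ LinearMap.trace ℂ V3 h = 0 ∧ LinearMap.det h = 0) ∧
    ∃ v : V3, ∃ hv : v ≠ 0, (herm v v).re < 0 ∧ ∀ h ∈ W, herm (h v) v = 0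

/-- The map `x ↦ ⟨x,p⟩·p`. -/
def wmap (p : V3) : Module.End ℂ V3 where
  toFun x := herm x p • p
  map_add' x y := by
    show herm (x + y) p • p = herm x p • p + herm y p • p
    have : herm (x + y) p = herm x p + herm y p := by
      simp only [herm, Pi.add_apply]; ring
    rw [this, add_smul]
  map_smul' c x := by
    show herm (c • x) p • p = c • (herm x p • p)
    have : herm (c • x) p = c * herm x p := by
      simp only [herm, Pi.smul_apply, smul_eq_mul]; ring
    rw [this, mul_smul]

/-- `ℙ(U)` for a complex subspace `U`. -/
def projC (U : Submodule ℂ V3) : Set PV :=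
  {q | ∃ v : V3, ∃ hv : v ≠ 0, v ∈ U ∧ q = projMk v hv}

/-- `ℙ(T)` for a real subspace `T`. -/
def projR (T : Submodule ℝ V3) : Set PV :=
  {q | ∃ v : V3, ∃ hv : v ≠ 0, v ∈ T ∧ q = projMk v hv}

/-- An `ℝ`-plane: `ℙ(T)` for a totally real `3`-dimensional real subspace `T`
with `ℂ·T = V`. -/
def IsRealPlane (T : Submodule ℝ V3) : Prop :=
  Module.finrank ℝ T = 3 ∧ Submodule.span ℂ (T : Set V3) = ⊤ ∧
    ∀ t ∈ T, ∀ t' ∈ T, (herm t t').im = 0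

/-- A geodesic: `ℙ(W₀)` for a `2`-dimensional real subspace `W₀` on which the form
is real-valued and not identically zero. -/
def IsGeodesic (W₀ : Submodule ℝ V3) : Prop :=
  Module.finrank ℝ W₀ = 2 ∧ (∀ w ∈ W₀, ∀ w' ∈ W₀, (herm w w').im = 0) ∧
    ∃ w ∈ W₀, ∃ w' ∈ W₀, herm w w' ≠ 0

/-- The real spine `R = {[h v] | [v] ∈ B_h, h v ≠ 0}` of `B_h`. -/
def RealSpine (h : Module.End ℂ V3) : Set PV :=
  {q | ∃ v : V3, ∃ hnz : h v ≠ 0, herm (h v) v = 0 ∧ q = projMk (h v) hnz}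

/-- The orthogonal complement w.r.t. the hermitian form. -/
def hermOrth (U : Submodule ℂ V3) : Submodule ℂ V3 where
  carrier := {x | ∀ u ∈ U, herm x u = 0}
  add_mem' := by
    intro a b ha hb u hu
    have h1 : herm (a + b) u = herm a u + herm b u := by
      simp only [herm, Pi.add_apply]; ring
    rw [h1, ha u hu, hb u hu, add_zero]
  zero_mem' := by
    intro u hu
    simp [herm]
  smul_mem' := by
    intro c x hx u hu
    have h1 : herm (c • x) u = c * herm x u := by
      simp only [herm, Pi.smul_apply, smul_eq_mul]; ring
    rw [h1, hx u hu, mul_zero]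

open Filter Topology

lemma herm_add_left (x y z : V3) : herm (x + y) z = herm x z + herm y z := by
  simp only [herm, Pi.add_apply]; ring

lemma herm_add_right (x y z : V3) : herm x (y + z) = herm x y + herm x z := by
  simp only [herm, Pi.add_apply, map_add]; ring

lemma herm_smul_left (c : ℂ) (x y : V3) : herm (c • x) y = c * herm x y := by
  simp only [herm, Pi.smul_apply, smul_eq_mul]; ring

lemma herm_smul_right (c : ℂ) (x y : V3) : herm x (c • y) = conj c * herm x y := by
  simp only [herm, Pi.smul_apply, smul_eq_mul, map_mul]; ring

lemma herm_zero_left (y : V3) : herm 0 y = 0 := by simp [herm]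

lemma herm_zero_right (y : V3) : herm y 0 = 0 := by simp [herm]

lemma conj_herm (x y : V3) : conj (herm x y) = herm y x := by
  simp only [herm, map_add, map_sub, map_mul, Complex.conj_conj]; ring

lemma ofReal_re_herm_self (x : V3) : (((herm x x).re : ℝ) : ℂ) = herm x x :=
  Complex.conj_eq_iff_re.mp (conj_herm x x)

lemma continuous_herm_self : Continuous fun v : V3 => herm v v := by
  unfold herm; fun_prop

lemma eq_zero_of_forall_herm {x : V3} (hx : ∀ y, herm x y = 0) : x = 0 := by
  funext i
  have := hx (Pi.single i 1)
  fin_cases i <;> simpa [herm] using this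

/-- The reversed Cauchy–Schwarz inequality in signature `(2,1)`. -/
lemma herm_self_pos_of_orth {f w : V3} (hf : (herm f f).re < 0) (hfw : herm w f = 0)
    (hw : w ≠ 0) : 0 < (herm w w).re := by
  by_contra! hle
  apply hw
  have hN : ∀ x : V3, (herm x x).re
      = Complex.normSq (x 0) + Complex.normSq (x 1) - Complex.normSq (x 2) := by
    intro x; simp [herm, Complex.normSq_apply]
  rw [hN] at hf hle
  have h2 : w 2 * conj (f 2) = w 0 * conj (f 0) + w 1 * conj (f 1) := by
    simp only [herm] at hfw; linear_combination -hfw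
  have h3 : Complex.normSq (w 2) * Complex.normSq (f 2)
      = Complex.normSq (w 0 * conj (f 0) + w 1 * conj (f 1)) := by
    rw [← h2, map_mul, Complex.normSq_conj]
  have h4 : Complex.normSq (w 0 * conj (f 0) + w 1 * conj (f 1))
      + Complex.normSq (w 0 * f 1 - w 1 * f 0)
      = (Complex.normSq (w 0) + Complex.normSq (w 1))
        * (Complex.normSq (f 0) + Complex.normSq (f 1)) := by
    simp [Complex.normSq_apply]; ring
  have n0 := Complex.normSq_nonneg (w 0)
  have n1 := Complex.normSq_nonneg (w 1)
  have n2 := Complex.normSq_nonneg (w 2)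
  have m0 := Complex.normSq_nonneg (f 0)
  have m1 := Complex.normSq_nonneg (f 1)
  have d := Complex.normSq_nonneg (w 0 * f 1 - w 1 * f 0)
  have hz : Complex.normSq (w 2) = 0 := by nlinarith
  have hz0 : Complex.normSq (w 0) = 0 := by linarith
  have hz1 : Complex.normSq (w 1) = 0 := by linarith
  rw [Complex.normSq_eq_zero] at hz hz0 hz1
  funext i; fin_cases i <;> simpa

lemma herm_repr {v : Fin 3 → V3} (hv : ∀ i j, i ≠ j → herm (v i) (v j) = 0)
    (c : Fin 3 → ℂ) (i : Fin 3) :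
    herm (∑ j, c j • v j) (v i) = c i * herm (v i) (v i) := by
  simp only [Fin.sum_univ_three, herm_add_left, herm_smul_left]
  fin_cases i <;> simp [hv]

lemma linearIndependent_of_orth {v : Fin 3 → V3} (hv : ∀ i j, i ≠ j → herm (v i) (v j) = 0)
    (hn : ∀ i, herm (v i) (v i) ≠ 0) : LinearIndependent ℂ v := by
  rw [Fintype.linearIndependent_iff]
  intro c hc i
  have := herm_repr hv c i
  rw [hc, herm_zero_left] at this
  simpa [hn i] using this.symm

lemma trace_eq_sum_of_orth (h : Module.End ℂ V3) {v : Fin 3 → V3}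
    (hv : ∀ i j, i ≠ j → herm (v i) (v j) = 0) (hn : ∀ i, herm (v i) (v i) ≠ 0) :
    LinearMap.trace ℂ V3 h = ∑ i, herm (h (v i)) (v i) / herm (v i) (v i) := by
  set b := basisOfLinearIndependentOfCardEqFinrank (linearIndependent_of_orth hv hn) (by simp)
    with hb
  have hbv : ∀ i, b i = v i := fun i => by simp [hb]
  rw [LinearMap.trace_eq_matrix_trace ℂ b h, Matrix.trace]
  refine Finset.sum_congr rfl fun i _ => ?_
  rw [Matrix.diag_apply, LinearMap.toMatrix_apply, hbv, eq_div_iff (hn i)]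
  conv_rhs => rw [← b.sum_repr (h (v i))]
  simp only [hbv]
  exact (herm_repr hv _ i).symm

section Forms

variable {h : Module.End ℂ V3}

lemma SelfAdj.conj_form (hs : SelfAdj h) (x y : V3) :
    conj (herm (h x) y) = herm (h y) x := by
  rw [conj_herm, ← hs]

lemma SelfAdj.ofReal_re_form (hs : SelfAdj h) (x : V3) :
    (((herm (h x) x).re : ℝ) : ℂ) = herm (h x) x :=
  Complex.conj_eq_iff_re.mp (hs.conj_form x x)

lemma SelfAdj.form_ker_right (hs : SelfAdj h) {f : V3} (hf : h f = 0) (x : V3) :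
    herm (h x) f = 0 := by
  rw [hs, hf, herm_zero_right]

lemma SelfAdj.form_add_ker (hs : SelfAdj h) {k : V3} (hk : h k = 0) (v : V3) :
    herm (h (k + v)) (k + v) = herm (h v) v := by
  rw [map_add, hk, zero_add, herm_add_right, hs.form_ker_right hk, zero_add]

lemma apply_eq_zero_of_form (hq : ∀ v, herm (h v) v = 0) (x : V3) :
    h x = 0 := by
  refine eq_zero_of_forall_herm fun y => ?_
  have h1 := hq (x + y)
  have h2 := hq (x + Complex.I • y)
  simp only [map_add, map_smul, herm_add_left, herm_add_right, herm_smul_left,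
    herm_smul_right, hq, Complex.conj_I] at h1 h2
  linear_combination (1 / 2 : ℂ) * h1 + (Complex.I / 2) * h2
    + (1 / 2) * (herm (h x) y - herm (h y) x) * Complex.I_sq

/-- Expansion of a hermitian form in real terms. -/
lemma SelfAdj.form_expand (hs : SelfAdj h) (a b c : V3) (x y z : ℂ) :
    herm (h (x • a + y • b + z • c)) (x • a + y • b + z • c)
      = ((Complex.normSq x * (herm (h a) a).re + Complex.normSq y * (herm (h b) b).re
        + Complex.normSq z * (herm (h c) c).re
        + 2 * (x * conj y * herm (h a) b + x * conj z * herm (h a) c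
          + y * conj z * herm (h b) c).re : ℝ) : ℂ) := by
  rw [← hs.ofReal_re_form]
  congr 1
  simp only [map_add, map_smul, herm_add_left, herm_add_right, herm_smul_left, herm_smul_right]
  rw [← hs.conj_form a b, ← hs.conj_form a c, ← hs.conj_form b c,
    ← hs.ofReal_re_form a, ← hs.ofReal_re_form b, ← hs.ofReal_re_form c]
  simp [Complex.normSq_apply]
  ring

lemma SelfAdj.form_expand_two (hs : SelfAdj h) (a b : V3) (x y : ℂ) :
    herm (h (x • a + y • b)) (x • a + y • b)
      = ((Complex.normSq x * (herm (h a) a).re + Complex.normSq y * (herm (h b) b).re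
        + 2 * (x * conj y * herm (h a) b).re : ℝ) : ℂ) := by
  simpa using hs.form_expand a b 0 x y 0

lemma projMk_mem_Bset {v : V3} (hv : v ≠ 0) : projMk v hv ∈ Bset h ↔ herm (h v) v = 0 := by
  refine ⟨?_, fun hq => ⟨v, hv, rfl, hq⟩⟩
  rintro ⟨w, hw, heq, hq⟩
  obtain ⟨a, rfl⟩ := (Projectivization.mk_eq_mk_iff' ℂ v w hv hw).mp heq
  simp [herm_smul_left, herm_smul_right, hq]

lemma Bset_congr {h' : Module.End ℂ V3}
    (hq : ∀ v, herm (h v) v = 0 ↔ herm (h' v) v = 0) : Bset h = Bset h' := by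
  simp only [Bset, hq]

lemma IsBisector.exists_ker (hb : IsBisector h) :
    ∃ f : V3, f ≠ 0 ∧ h f = 0 ∧ ∀ x, h x = 0 → ∃ c : ℂ, c • f = x := by
  have h1 := LinearMap.finrank_range_add_finrank_ker h
  have h2 : Module.finrank ℂ (LinearMap.ker h) = 1 := by
    rw [hb.2.2.1] at h1; simp at h1; omega
  obtain ⟨⟨f, hf⟩, hne, hall⟩ := finrank_eq_one_iff'.mp h2
  refine ⟨f, fun h0 => hne (by simp [h0]), hf, fun x hx => ?_⟩
  obtain ⟨c, hc⟩ := hall ⟨x, hx⟩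
  exact ⟨c, congrArg Subtype.val hc⟩

lemma IsBisector.exists_form_ne_zero (hb : IsBisector h) : ∃ v, herm (h v) v ≠ 0 := by
  by_contra! hq
  obtain ⟨v, -, hv⟩ := hb.2.2.2
  exact hv (apply_eq_zero_of_form hq v)

end Forms

/-- A pair of independent vectors spanning a subspace isotropic for both forms is a
common slice. -/
lemma exists_slice {h₁ h₂ : Module.End ℂ V3} {a b : V3} (hi : LinearIndependent ℂ ![a, b])
    (hq : ∀ x y : ℂ, herm (h₁ (x • a + y • b)) (x • a + y • b) = 0 ∧
      herm (h₂ (x • a + y • b)) (x • a + y • b) = 0) :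
    ∃ U : Submodule ℂ V3, Module.finrank ℂ U = 2 ∧ projC U ⊆ Bset h₁ ∩ Bset h₂ := by
  refine ⟨Submodule.span ℂ {a, b}, ?_, ?_⟩
  · have := finrank_span_eq_card hi
    rwa [Matrix.range_cons_cons_empty, Fintype.card_fin] at this
  · rintro _ ⟨v, hv, hvU, rfl⟩
    obtain ⟨x, y, rfl⟩ := Submodule.mem_span_pair.mp hvU
    exact ⟨(projMk_mem_Bset hv).mpr (hq x y).1, (projMk_mem_Bset hv).mpr (hq x y).2⟩

/-- A common kernel vector together with a common isotropic vector span a common slice. -/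
lemma exists_slice_of_ker {h₁ h₂ : Module.End ℂ V3} (hs₁ : SelfAdj h₁) (hs₂ : SelfAdj h₂)
    {f m : V3} (h1f : h₁ f = 0) (h2f : h₂ f = 0) (hi : LinearIndependent ℂ ![f, m])
    (h1m : herm (h₁ m) m = 0) (h2m : herm (h₂ m) m = 0) :
    ∃ U : Submodule ℂ V3, Module.finrank ℂ U = 2 ∧ projC U ⊆ Bset h₁ ∩ Bset h₂ := by
  refine exists_slice hi fun x y => ⟨?_, ?_⟩
  · rw [hs₁.form_expand_two]; simp [h1f, h1m, herm_zero_left]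
  · rw [hs₂.form_expand_two]; simp [h2f, h2m, herm_zero_left]

/-- The vector orthogonal to both `f` and `w` given by the hermitian cross product. -/
def hermCross (f w : V3) : V3 :=
  ![conj (f 1 * w 2 - f 2 * w 1), conj (f 2 * w 0 - f 0 * w 2),
    -conj (f 0 * w 1 - f 1 * w 0)]

lemma herm_hermCross_left (f w : V3) : herm f (hermCross f w) = 0 := by
  simp [herm, hermCross]; ring

lemma herm_hermCross_right (f w : V3) : herm w (hermCross f w) = 0 := by
  simp [herm, hermCross]; ring

lemma herm_hermCross_self (f w : V3) :
    herm (hermCross f w) (hermCross f w) = herm f w * herm w f - herm f f * herm w w := by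
  simp [herm, hermCross]; ring

lemma exists_real_quadratic_zero {α β : ℝ} (k : ℝ) (hαβ : α * β ≤ 0) :
    ∃ a b : ℝ, (a ≠ 0 ∨ b ≠ 0) ∧ a ^ 2 * α + b ^ 2 * β + 2 * (a * b * k) = 0 := by
  by_cases hα : α = 0
  · exact ⟨1, 0, by simp, by simp [hα]⟩
  · refine ⟨-k + √(k ^ 2 - α * β), α, Or.inr hα, ?_⟩
    have := Real.sq_sqrt (show 0 ≤ k ^ 2 - α * β by nlinarith [sq_nonneg k])
    linear_combination α * this

/-- Two bisectors with a common negative focus have a common slice. -/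
lemma exists_slice_of_neg_focus {h₁ h₂ : Module.End ℂ V3} (hb₁ : IsBisector h₁)
    (hb₂ : IsBisector h₂) {f : V3} (h1f : h₁ f = 0) (h2f : h₂ f = 0)
    (hf : (herm f f).re < 0) :
    ∃ U : Submodule ℂ V3, Module.finrank ℂ U = 2 ∧ projC U ⊆ Bset h₁ ∩ Bset h₂ := by
  have hff : herm f f ≠ 0 := fun h0 => by simp [h0] at hf
  obtain ⟨w₀, hw₀, hne₀⟩ := hb₁.2.2.2
  obtain ⟨w, hqw, hwf, hw⟩ : ∃ w, herm (h₁ w) w = 0 ∧ herm w f = 0 ∧ w ≠ 0 := by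
    refine ⟨(-(herm w₀ f / herm f f)) • f + w₀, ?_, ?_, ?_⟩
    · rw [hb₁.1.form_add_ker (by rw [map_smul, h1f, smul_zero]), hw₀]
    · rw [herm_add_left, herm_smul_left]; field_simp; ring
    · intro h0
      have := congrArg h₁ h0
      simp [h1f] at this
      exact hne₀ this
  have hwpos := herm_self_pos_of_orth hf hwf hw
  have hfw : herm f w = 0 := by rw [← conj_herm, hwf, map_zero]
  have hww : herm w w ≠ 0 := fun h0 => by simp [h0] at hwpos
  set u := hermCross f w with hu
  have hfu : herm f u = 0 := herm_hermCross_left f w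
  have hwu : herm w u = 0 := herm_hermCross_right f w
  have huf : herm u f = 0 := by rw [← conj_herm, hfu, map_zero]
  have huw : herm u w = 0 := by rw [← conj_herm, hwu, map_zero]
  have huu : herm u u ≠ 0 := by
    rw [hu, herm_hermCross_self, hfw, zero_mul, zero_sub]
    exact neg_ne_zero.mpr (mul_ne_zero hff hww)
  have hupos := herm_self_pos_of_orth hf huf
    (fun h0 => huu (by rw [h0, herm_zero_left]))
  have htr : ∀ h : Module.End ℂ V3, IsBisector h → h f = 0 →
      (herm (h w) w).re / (herm w w).re + (herm (h u) u).re / (herm u u).re = 0 := by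
    intro h hb h0
    have := trace_eq_sum_of_orth h (v := ![f, w, u])
      (by intro i j hij; fin_cases i <;> fin_cases j <;> simp_all)
      (by intro i; fin_cases i <;> simp [hff, hww, huu])
    rw [hb.2.1, Fin.sum_univ_three] at this
    simp only [Matrix.cons_val, h0, herm_zero_left, zero_div, zero_add] at this
    rw [← hb.1.ofReal_re_form w, ← hb.1.ofReal_re_form u, ← ofReal_re_herm_self w,
      ← ofReal_re_herm_self u] at this
    exact_mod_cast this.symm
  have h1u : (herm (h₁ u) u).re = 0 := by
    have := htr h₁ hb₁ h1f
    simpa [hqw, hupos.ne'] using this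
  obtain ⟨η, hη, hηre⟩ : ∃ η : ℂ, η ≠ 0 ∧ (conj η * herm (h₁ w) u).re = 0 := by
    by_cases hγ : herm (h₁ w) u = 0
    · exact ⟨1, one_ne_zero, by simp [hγ]⟩
    · refine ⟨Complex.I * herm (h₁ w) u, mul_ne_zero Complex.I_ne_zero hγ, ?_⟩
      simp; ring
  have hαβ : (herm (h₂ w) w).re * (Complex.normSq η * (herm (h₂ u) u).re) ≤ 0 := by
    have := htr h₂ hb₂ h2f
    have h3 : (herm (h₂ u) u).re = -((herm (h₂ w) w).re * ((herm u u).re / (herm w w).re)) := by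
      field_simp at this ⊢; linarith
    rw [h3]
    have h4 : 0 ≤ Complex.normSq η * ((herm (h₂ w) w).re ^ 2 *
      ((herm u u).re / (herm w w).re)) := by
      have := Complex.normSq_nonneg η
      positivity
    linarith
  obtain ⟨a, b, hab, hzero⟩ :=
    exists_real_quadratic_zero (conj η * herm (h₂ w) u).re hαβ
  have hbη : ∀ γ : ℂ, ((a : ℂ) * conj (b * η) * γ).re = a * b * (conj η * γ).re := by
    intro γ; simp; ring
  have hm1 : herm (h₁ ((a : ℂ) • w + (b * η) • u)) ((a : ℂ) • w + (b * η) • u) = 0 := by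
    rw [hb₁.1.form_expand_two, hbη, hηre, hqw, h1u]; simp
  have hm2 : herm (h₂ ((a : ℂ) • w + (b * η) • u)) ((a : ℂ) • w + (b * η) • u) = 0 := by
    rw [hb₂.1.form_expand_two, hbη, Complex.ofReal_eq_zero, ← hzero, map_mul,
      Complex.normSq_ofReal, Complex.normSq_ofReal]
    ring
  refine exists_slice_of_ker hb₁.1 hb₂.1 h1f h2f ?_ hm1 hm2
  rw [LinearIndependent.pair_iff]
  intro s t hst
  have e1 := congrArg (fun v => herm v f) hst
  have e2 := congrArg (fun v => herm v w) hst
  have e3 := congrArg (fun v => herm v u) hst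
  simp only [herm_add_left, herm_smul_left, hwf, huf, hfw, huw, hfu, hwu, herm_zero_left,
    mul_zero, add_zero, zero_add] at e1 e2 e3
  simp [hff, hww, huu, hη] at e1 e2 e3
  exact ⟨e1, by tauto⟩

/-- Two bisectors with a common focus that meet in the ball have a common slice. -/
lemma exists_slice_of_common_focus {h₁ h₂ : Module.End ℂ V3} (hb₁ : IsBisector h₁)
    (hb₂ : IsBisector h₂) {f : V3} (hf : f ≠ 0) (h1f : h₁ f = 0) (h2f : h₂ f = 0)
    (hD : ∃ v : V3, (herm v v).re < 0 ∧ herm (h₁ v) v = 0 ∧ herm (h₂ v) v = 0) :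
    ∃ U : Submodule ℂ V3, Module.finrank ℂ U = 2 ∧ projC U ⊆ Bset h₁ ∩ Bset h₂ := by
  obtain ⟨v, hv, h1v, h2v⟩ := hD
  by_cases hi : LinearIndependent ℂ ![f, v]
  · exact exists_slice_of_ker hb₁.1 hb₂.1 h1f h2f hi h1v h2v
  · rw [LinearIndependent.pair_iff' hf] at hi
    push Not at hi
    obtain ⟨c, rfl⟩ := hi
    exact exists_slice_of_neg_focus hb₁ hb₂ (by rw [map_smul, h1f, smul_zero])
      (by rw [map_smul, h2f, smul_zero]) hv

/-- Normal form of a bisector with focus `f` for which the line through `f` and `e` is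
not a slice. -/
lemma IsBisector.exists_normal_form {h : Module.End ℂ V3} (hb : IsBisector h) {f e w : V3}
    (hf : h f = 0) (hspan : ∀ v, ∃ x y z : ℂ, v = x • f + y • e + z • w)
    (hker : ∀ c : ℂ, h (w + c • e) ≠ 0) (he : herm (h e) e ≠ 0) :
    ∃ μ c : ℂ, ∃ r : ℝ, μ ≠ 0 ∧ r ≠ 0 ∧ ∀ x y z : ℂ,
      herm (h (x • f + y • (μ • e) + z • (w + c • e)))
        (x • f + y • (μ • e) + z • (w + c • e))
        = ((r * (Complex.normSq y - Complex.normSq z) : ℝ) : ℂ) := by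
  have hs := hb.1
  obtain ⟨c, hc⟩ : ∃ c : ℂ, herm (h (w + c • e)) e = 0 := by
    refine ⟨-(herm (h w) e / herm (h e) e), ?_⟩
    simp only [map_add, map_smul, herm_add_left, herm_smul_left]
    field_simp; ring
  set w' := w + c • e with hw'
  have hc' : herm (h e) w' = 0 := by rw [← hs.conj_form, hc, map_zero]
  have hexp : ∀ x y z : ℂ, herm (h (x • f + y • e + z • w')) (x • f + y • e + z • w')
      = ((Complex.normSq y * (herm (h e) e).re + Complex.normSq z * (herm (h w') w').re : ℝ) :
        ℂ) := by
    intro x y z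
    rw [hs.form_expand]
    simp [hf, herm_zero_left, hc']
  have hα : (herm (h e) e).re ≠ 0 := fun h0 => he (by rw [← hs.ofReal_re_form, h0]; simp)
  have hβ : (herm (h w') w').re ≠ 0 := by
    intro h0
    refine hker c (eq_zero_of_forall_herm fun v => ?_)
    obtain ⟨x, y, z, rfl⟩ := hspan v
    have h1 : herm (h w') w' = 0 := by rw [← hs.ofReal_re_form, h0]; simp
    have h2 : w = w' + (-c) • e := by rw [hw']; module
    rw [← hw', h2]
    simp only [herm_add_right, herm_smul_right, h1, hc, hs.form_ker_right hf]
    simp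
  obtain ⟨v, hv, hne⟩ := hb.2.2.2
  obtain ⟨x, y, z, rfl⟩ := hspan v
  have h2 : x • f + y • e + z • w = x • f + (y - z * c) • e + z • w' := by rw [hw']; module
  rw [h2] at hv hne
  rw [hexp, Complex.ofReal_eq_zero] at hv
  set y' := y - z * c
  have hz : z ≠ 0 := by
    rintro rfl
    have : y' = 0 := by simpa [hα] using hv
    simp [this, hf] at hne
  have hzn : Complex.normSq z ≠ 0 := by simpa using hz
  refine ⟨y' / z, c, -(herm (h w') w').re, ?_, neg_ne_zero.mpr hβ, fun a b d => ?_⟩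
  · intro h0
    have : y' = 0 := by simpa [hz] using h0
    simp [this, hβ, hz] at hv
  · rw [smul_smul, hexp, Complex.ofReal_inj, map_mul, map_div₀]
    field_simp
    linear_combination Complex.normSq b * hv

/-- Normal form of a bisector with focus `f` for which the line through `f` and `e` is
a slice. -/
lemma IsBisector.exists_normal_form_of_slice {h : Module.End ℂ V3} (hb : IsBisector h)
    {f e w : V3} (hf : h f = 0) (hspan : ∀ v, ∃ x y z : ℂ, v = x • f + y • e + z • w)
    (hker : h e ≠ 0) (he : herm (h e) e = 0) :
    ∃ μ c : ℂ, μ ≠ 0 ∧ ∀ x y z : ℂ,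
      herm (h (x • f + y • (μ • e) + z • (w + c • e)))
        (x • f + y • (μ • e) + z • (w + c • e))
        = ((2 * (y * conj z).re : ℝ) : ℂ) := by
  have hs := hb.1
  have hγ : herm (h e) w ≠ 0 := by
    intro h0
    refine hker (eq_zero_of_forall_herm fun v => ?_)
    obtain ⟨x, y, z, rfl⟩ := hspan v
    simp [herm_add_right, herm_smul_right, h0, he, hs.form_ker_right hf]
  set γ := herm (h e) w with hγdef
  set c : ℂ := -(herm (h w) w / (2 * γ)) with hc
  have hcγ : 2 * (c * γ).re = -(herm (h w) w).re := by
    have : c * γ = -(((herm (h w) w).re / 2 : ℝ) : ℂ) := by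
      rw [hc, ← hs.ofReal_re_form w, Complex.ofReal_re]; push_cast; field_simp
    rw [this, ← Complex.ofReal_neg, Complex.ofReal_re]; ring
  refine ⟨γ⁻¹, c, inv_ne_zero hγ, fun x y z => ?_⟩
  have h2 : x • f + y • (γ⁻¹ • e) + z • (w + c • e)
      = x • f + (y * γ⁻¹ + z * c) • e + z • w := by module
  rw [h2, hs.form_expand, Complex.ofReal_inj, he, hf]
  have h3 : (y * γ⁻¹ + z * c) * conj z * γ = y * conj z + Complex.normSq z * (c * γ) := by
    rw [Complex.normSq_eq_conj_mul_self]; field_simp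
  simp only [herm_zero_left, mul_zero, zero_add, Complex.zero_re, ← hγdef, h3, Complex.add_re,
    Complex.re_ofReal_mul]
  linear_combination Complex.normSq z * hcγ

lemma quadratic_coeff_eq_zero {a b c : ℝ}
    (h : ∀ᶠ t : ℝ in 𝓝 0, a + b * t + c * t ^ 2 = 0) : a = 0 ∧ b = 0 ∧ c = 0 := by
  obtain ⟨ε, hε, hball⟩ := Metric.eventually_nhds_iff.mp h
  have h0 := hball (y := 0) (by simpa using hε)
  have h1 := hball (y := ε / 2) (by simp [abs_of_pos hε]; linarith)
  have h2 := hball (y := -(ε / 2)) (by simp [abs_of_pos hε]; linarith)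
  have ha : a = 0 := by linarith
  have hb : b * ε = 0 := by linarith
  have hb : b = 0 := by simpa [hε.ne'] using hb
  subst ha hb
  exact ⟨rfl, rfl, by simpa [hε.ne'] using h1⟩

lemma trig_coeff_eq_zero {c : ℝ} {A : ℂ}
    (h : ∀ᶠ θ : ℝ in 𝓝 0, c + 2 * (A * Complex.exp (θ * Complex.I)).re = 0) :
    c = 0 ∧ A = 0 := by
  obtain ⟨ε, hε, hball⟩ := Metric.eventually_nhds_iff.mp h
  set t := min (ε / 2) 1 with ht
  have ht0 : 0 < t := by positivity
  have ht1 : t ≤ 1 := min_le_right _ _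
  have htε : t < ε := (min_le_left _ _).trans_lt (by linarith)
  have hsin : 0 < Real.sin t := Real.sin_pos_of_pos_of_le_one ht0 ht1
  have hcos : Real.cos t < 1 := by
    have := Real.sin_sq_add_cos_sq t
    nlinarith
  have h0 := hball (y := 0) (by simpa using hε)
  have h1 := hball (y := t) (by simpa [abs_of_pos ht0] using htε)
  have h2 := hball (y := -t) (by simpa [abs_of_pos ht0] using htε)
  simp only [Complex.mul_re, Complex.exp_ofReal_mul_I_re, Complex.exp_ofReal_mul_I_im,
    Real.cos_neg, Real.sin_neg, Real.cos_zero, Real.sin_zero] at h0 h1 h2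
  have hre : A.re * (1 - Real.cos t) = 0 := by linarith
  have hre : A.re = 0 := by simpa [sub_ne_zero.mpr hcos.ne'] using hre
  have him : A.im * Real.sin t = 0 := by linarith
  have him : A.im = 0 := by simpa [hsin.ne'] using him
  exact ⟨by rw [hre] at h0; linarith, Complex.ext hre him⟩

lemma trig_linear_coeff_eq_zero {A B : ℂ}
    (h : ∀ᶠ θ : ℝ in 𝓝 0, A + B * Complex.exp (θ * Complex.I) = 0) : A = 0 ∧ B = 0 := by
  have hB : B = 0 := by
    refine (trig_coeff_eq_zero (c := 2 * A.re) ?_).2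
    filter_upwards [h] with θ hθ
    have := congrArg Complex.re hθ
    simp only [Complex.add_re, Complex.zero_re] at this
    linarith
  subst hB
  exact ⟨by simpa using h.self_of_nhds, rfl⟩

lemma normSq_exp_ofReal_mul_I (θ : ℝ) : Complex.normSq (Complex.exp (θ * Complex.I)) = 1 := by
  rw [Complex.normSq_eq_norm_sq, Complex.norm_exp_ofReal_mul_I, one_pow]

lemma conj_exp_ofReal_mul_I_mul (θ : ℝ) :
    conj (Complex.exp (θ * Complex.I)) * Complex.exp (θ * Complex.I) = 1 := by
  rw [← Complex.normSq_eq_conj_mul_self, normSq_exp_ofReal_mul_I, Complex.ofReal_one]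

lemma isOpen_inter_neg {U : Set V3} (hU : IsOpen U) :
    IsOpen (U ∩ {v | (herm v v).re < 0}) :=
  hU.inter (isOpen_lt (Complex.continuous_re.comp continuous_herm_self) continuous_const)

/-- A hermitian form vanishing on an open piece of the torus `|x| = |y| = |z|` is diagonal
and traceless. -/
lemma SelfAdj.torus_rigidity {h : Module.End ℂ V3} (hs : SelfAdj h) {a b c : V3}
    {N : Set V3} (hN : IsOpen N) {x₀ y₀ z₀ : ℂ} (h0N : x₀ • a + y₀ • b + z₀ • c ∈ N)
    (hxz : Complex.normSq x₀ = Complex.normSq z₀) (hyz : Complex.normSq y₀ = Complex.normSq z₀)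
    (hz₀ : z₀ ≠ 0)
    (hvan : ∀ x y z : ℂ, x • a + y • b + z • c ∈ N → Complex.normSq x = Complex.normSq z →
      Complex.normSq y = Complex.normSq z →
      herm (h (x • a + y • b + z • c)) (x • a + y • b + z • c) = 0) :
    ∃ s t : ℝ, ∀ x y z : ℂ, herm (h (x • a + y • b + z • c)) (x • a + y • b + z • c)
      = ((s * (Complex.normSq y - Complex.normSq z) + t * (Complex.normSq x - Complex.normSq z) :
        ℝ) : ℂ) := by
  have hnz : Complex.normSq z₀ ≠ 0 := by simpa using hz₀
  have hx₀ : x₀ ≠ 0 := fun h0 => hnz (by rw [← hxz, h0, map_zero])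
  have hy₀ : y₀ ≠ 0 := fun h0 => hnz (by rw [← hyz, h0, map_zero])
  set E : ℝ → ℂ := fun θ => Complex.exp (θ * Complex.I) with hE
  have hcont : Continuous fun p : ℝ × ℝ =>
      (x₀ * E p.2) • a + (y₀ * E p.1) • b + z₀ • c := by
    rw [hE]; fun_prop
  have hev : ∀ᶠ p : ℝ × ℝ in 𝓝 (0, 0), (x₀ * E p.2) • a + (y₀ * E p.1) • b + z₀ • c ∈ N :=
    hcont.continuousAt.eventually (hN.mem_nhds (by simpa [hE] using h0N))
  rw [nhds_prod_eq] at hev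
  have hfib : ∀ᶠ φ : ℝ in 𝓝 0,
      (Complex.normSq z₀ * ((herm (h a) a).re + (herm (h b) b).re + (herm (h c) c).re)
        + 2 * (y₀ * conj z₀ * herm (h b) c * E φ).re = 0) ∧
      x₀ * conj y₀ * herm (h a) b + x₀ * conj z₀ * herm (h a) c * E φ = 0 := by
    filter_upwards [hev.curry] with φ hφ
    have := trig_coeff_eq_zero
      (c := Complex.normSq z₀ * ((herm (h a) a).re + (herm (h b) b).re + (herm (h c) c).re)
        + 2 * (y₀ * conj z₀ * herm (h b) c * E φ).re)
      (A := x₀ * conj (y₀ * E φ) * herm (h a) b + x₀ * conj z₀ * herm (h a) c) (by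
        filter_upwards [hφ] with θ hθ
        have hq := hvan _ _ _ hθ (by rw [map_mul, normSq_exp_ofReal_mul_I, mul_one, hxz])
          (by rw [map_mul, normSq_exp_ofReal_mul_I, mul_one, hyz])
        rw [hs.form_expand, Complex.ofReal_eq_zero, map_mul, map_mul,
          normSq_exp_ofReal_mul_I, normSq_exp_ofReal_mul_I, hxz, hyz] at hq
        rw [← hq]
        have e1 : x₀ * E θ * conj (y₀ * E φ) * herm (h a) b + x₀ * E θ * conj z₀ * herm (h a) c
            + y₀ * E φ * conj z₀ * herm (h b) c
            = (x₀ * conj (y₀ * E φ) * herm (h a) b + x₀ * conj z₀ * herm (h a) c) * E θ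
              + y₀ * conj z₀ * herm (h b) c * E φ := by ring
        rw [e1, Complex.add_re]
        ring)
    refine ⟨this.1, ?_⟩
    have h2 := congrArg (· * E φ) this.2
    simp only [zero_mul, map_mul] at h2
    have hEE : conj (E φ) * E φ = 1 := conj_exp_ofReal_mul_I_mul φ
    linear_combination h2 - x₀ * conj y₀ * herm (h a) b * hEE
  obtain ⟨htr, hbc⟩ := trig_coeff_eq_zero (hfib.mono fun _ hφ => hφ.1)
  obtain ⟨hab, hac⟩ := trig_linear_coeff_eq_zero (hfib.mono fun _ hφ => hφ.2)
  simp only [mul_eq_zero, map_eq_zero, hx₀, hy₀, hz₀, false_or] at hbc hab hac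
  replace htr := (mul_eq_zero.mp htr).resolve_left hnz
  refine ⟨(herm (h b) b).re, (herm (h a) a).re, fun x y z => ?_⟩
  rw [hs.form_expand, hab, hac, hbc, Complex.ofReal_inj]
  simp only [mul_zero, add_zero, Complex.zero_re]
  linear_combination Complex.normSq z * htr

/-- A hermitian form vanishing on an open piece of the cylinder `|x| = |z|`, `Re (y z̄) = 0`
is a combination of the two defining forms. -/
lemma SelfAdj.cylinder_rigidity {h : Module.End ℂ V3} (hs : SelfAdj h) {a b c : V3}
    {N : Set V3} (hN : IsOpen N) {x₀ y₀ z₀ : ℂ} (h0N : x₀ • a + y₀ • b + z₀ • c ∈ N)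
    (hxz : Complex.normSq x₀ = Complex.normSq z₀) (hyz : (y₀ * conj z₀).re = 0)
    (hz₀ : z₀ ≠ 0)
    (hvan : ∀ x y z : ℂ, x • a + y • b + z • c ∈ N → Complex.normSq x = Complex.normSq z →
      (y * conj z).re = 0 →
      herm (h (x • a + y • b + z • c)) (x • a + y • b + z • c) = 0) :
    ∃ s t : ℝ, ∀ x y z : ℂ, herm (h (x • a + y • b + z • c)) (x • a + y • b + z • c)
      = ((s * (y * conj z).re + t * (Complex.normSq x - Complex.normSq z) : ℝ) : ℂ) := by
  have hnz : Complex.normSq z₀ ≠ 0 := by simpa using hz₀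
  have hx₀ : x₀ ≠ 0 := fun h0 => hnz (by rw [← hxz, h0, map_zero])
  set E : ℝ → ℂ := fun θ => Complex.exp (θ * Complex.I) with hE
  set Y : ℝ → ℂ := fun t => y₀ + t * Complex.I * z₀ with hY
  have hcont : Continuous fun p : ℝ × ℝ => (x₀ * E p.2) • a + Y p.1 • b + z₀ • c := by
    rw [hE, hY]; fun_prop
  have hev : ∀ᶠ p : ℝ × ℝ in 𝓝 (0, 0), (x₀ * E p.2) • a + Y p.1 • b + z₀ • c ∈ N :=
    hcont.continuousAt.eventually (hN.mem_nhds (by simpa [hE, hY] using h0N))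
  rw [nhds_prod_eq] at hev
  have hfib : ∀ᶠ t : ℝ in 𝓝 0,
      (Complex.normSq z₀ * ((herm (h a) a).re + (herm (h c) c).re)
        + Complex.normSq (Y t) * (herm (h b) b).re
        + 2 * (Y t * conj z₀ * herm (h b) c).re = 0) ∧
      conj (Y t) * herm (h a) b + conj z₀ * herm (h a) c = 0 := by
    filter_upwards [hev.curry] with t ht
    have := trig_coeff_eq_zero
      (c := Complex.normSq z₀ * ((herm (h a) a).re + (herm (h c) c).re)
        + Complex.normSq (Y t) * (herm (h b) b).re
        + 2 * (Y t * conj z₀ * herm (h b) c).re)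
      (A := x₀ * (conj (Y t) * herm (h a) b + conj z₀ * herm (h a) c)) (by
        filter_upwards [ht] with θ hθ
        have hq := hvan _ _ _ hθ (by rw [map_mul, normSq_exp_ofReal_mul_I, mul_one, hxz])
          (by
            have : Y t * conj z₀ = y₀ * conj z₀
                + ((t * Complex.normSq z₀ : ℝ) : ℂ) * Complex.I := by
              rw [hY, Complex.ofReal_mul, Complex.normSq_eq_conj_mul_self]; ring
            rw [this, Complex.add_re, hyz, Complex.re_ofReal_mul]; simp)
        rw [hs.form_expand, Complex.ofReal_eq_zero, map_mul, normSq_exp_ofReal_mul_I, hxz] at hq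
        rw [← hq]
        have e1 : x₀ * E θ * conj (Y t) * herm (h a) b + x₀ * E θ * conj z₀ * herm (h a) c
            + Y t * conj z₀ * herm (h b) c
            = x₀ * (conj (Y t) * herm (h a) b + conj z₀ * herm (h a) c) * E θ
              + Y t * conj z₀ * herm (h b) c := by ring
        rw [e1, Complex.add_re]
        ring)
    exact ⟨this.1, (mul_eq_zero.mp this.2).resolve_left hx₀⟩
  have hab : herm (h a) b = 0 := by
    obtain ⟨ε, hε, hball⟩ := Metric.eventually_nhds_iff.mp hfib
    have h0 := (hball (y := 0) (by simpa using hε)).2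
    have h1 := (hball (y := ε / 2) (by simp [abs_of_pos hε]; linarith)).2
    simp only [hY, map_add, map_mul, Complex.conj_ofReal, Complex.conj_I] at h0 h1
    have : (((ε / 2 : ℝ) : ℂ) * Complex.I * conj z₀) * herm (h a) b = 0 := by
      push_cast at h0 h1 ⊢
      linear_combination h0 - h1
    refine (mul_eq_zero.mp this).resolve_left ?_
    simp [hε.ne', hz₀]
  have hac : herm (h a) c = 0 := by
    have := hfib.self_of_nhds.2
    simpa [hab, hz₀] using this
  obtain ⟨e0, e1, e2⟩ := quadratic_coeff_eq_zero
    (a := Complex.normSq z₀ * ((herm (h a) a).re + (herm (h c) c).re)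
      + Complex.normSq y₀ * (herm (h b) b).re + 2 * (y₀ * conj z₀ * herm (h b) c).re)
    (b := 2 * (y₀ * conj z₀).im * (herm (h b) b).re
      - 2 * Complex.normSq z₀ * (herm (h b) c).im)
    (c := Complex.normSq z₀ * (herm (h b) b).re) (by
      filter_upwards [hfib] with t ht
      rw [← ht.1, hY]
      simp [Complex.normSq_apply]
      ring)
  have hbb : (herm (h b) b).re = 0 := (mul_eq_zero.mp e2).resolve_left hnz
  have him : (herm (h b) c).im = 0 := by simpa [hbb, hnz, hz₀] using e1
  have htr : (herm (h a) a).re + (herm (h c) c).re = 0 := by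
    have : (y₀ * conj z₀ * herm (h b) c).re = 0 := by
      rw [Complex.mul_re, hyz, him]; ring
    simpa [hbb, this, hnz, hz₀] using e0
  refine ⟨2 * (herm (h b) c).re, (herm (h a) a).re, fun x y z => ?_⟩
  rw [hs.form_expand, hab, hac, hbb, Complex.ofReal_inj]
  simp only [mul_zero, zero_add, add_zero]
  rw [Complex.mul_re _ (herm (h b) c), him]
  linear_combination Complex.normSq z * htr

lemma Bset_eq_of_form_smul {h h' : Module.End ℂ V3} (hb : IsBisector h) {s : ℝ}
    (hq : ∀ v, herm (h v) v = s * herm (h' v) v) : Bset h = Bset h' := by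
  have hs : (s : ℂ) ≠ 0 := by
    intro h0
    obtain ⟨v, hv⟩ := hb.exists_form_ne_zero
    exact hv (by rw [hq, h0, zero_mul])
  exact Bset_congr fun v => by rw [hq, mul_eq_zero, or_iff_right hs]

/-- Giraud rigidity when neither bisector has the line through the two foci as a slice. -/
lemma giraud_torus {h₁ h₂ : Module.End ℂ V3} {a b c : V3} {r₁ r₂ : ℝ}
    (hr₁ : r₁ ≠ 0) (hr₂ : r₂ ≠ 0)
    (hspan : ∀ v, ∃ x y z : ℂ, v = x • a + y • b + z • c)
    (hq₁ : ∀ x y z : ℂ, herm (h₁ (x • a + y • b + z • c)) (x • a + y • b + z • c)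
      = ((r₁ * (Complex.normSq y - Complex.normSq z) : ℝ) : ℂ))
    (hq₂ : ∀ x y z : ℂ, herm (h₂ (x • a + y • b + z • c)) (x • a + y • b + z • c)
      = ((r₂ * (Complex.normSq x - Complex.normSq z) : ℝ) : ℂ))
    {N : Set V3} (hN : IsOpen N) (hne : ∃ v ∈ N, v ≠ 0 ∧ herm (h₁ v) v = 0 ∧ herm (h₂ v) v = 0)
    {h : Module.End ℂ V3} (hb : IsBisector h) (hne₁ : Bset h ≠ Bset h₁) (hne₂ : Bset h ≠ Bset h₂)
    (hvan : ∀ v ∈ N, herm (h₁ v) v = 0 → herm (h₂ v) v = 0 → herm (h v) v = 0) :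
    ∃ s : ℝ, s ≠ 0 ∧ ∀ x y z : ℂ, herm (h (x • a + y • b + z • c)) (x • a + y • b + z • c)
      = ((s * (Complex.normSq y - Complex.normSq x) : ℝ) : ℂ) := by
  obtain ⟨v, hvN, hv0, h1v, h2v⟩ := hne
  obtain ⟨x₀, y₀, z₀, rfl⟩ := hspan v
  have hy : Complex.normSq y₀ = Complex.normSq z₀ := by
    rw [hq₁, Complex.ofReal_eq_zero] at h1v
    exact sub_eq_zero.mp ((mul_eq_zero.mp h1v).resolve_left hr₁)
  have hx : Complex.normSq x₀ = Complex.normSq z₀ := by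
    rw [hq₂, Complex.ofReal_eq_zero] at h2v
    exact sub_eq_zero.mp ((mul_eq_zero.mp h2v).resolve_left hr₂)
  have hz₀ : z₀ ≠ 0 := by
    rintro rfl
    simp only [map_zero, Complex.normSq_eq_zero] at hx hy
    simp [hx, hy] at hv0
  obtain ⟨s, t, hst⟩ := hb.1.torus_rigidity hN hvN hx hy hz₀ fun x y z hm hxz hyz =>
    hvan _ hm (by rw [hq₁, hyz]; simp) (by rw [hq₂, hxz]; simp)
  have hs : s ≠ 0 := by
    rintro rfl
    refine hne₂ (Bset_eq_of_form_smul hb (s := t / r₂) fun v => ?_)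
    obtain ⟨x, y, z, rfl⟩ := hspan v
    rw [hst, hq₂, ← Complex.ofReal_mul]
    congr 1; field_simp; ring
  have ht : t ≠ 0 := by
    rintro rfl
    refine hne₁ (Bset_eq_of_form_smul hb (s := s / r₁) fun v => ?_)
    obtain ⟨x, y, z, rfl⟩ := hspan v
    rw [hst, hq₁, ← Complex.ofReal_mul]
    congr 1; field_simp; ring
  obtain ⟨k, hk0, hk, -⟩ := hb.exists_ker
  obtain ⟨x, y, z, rfl⟩ := hspan k
  have hadd : ∀ x' y' z' : ℂ,
      s * (Complex.normSq (y + y') - Complex.normSq (z + z'))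
          + t * (Complex.normSq (x + x') - Complex.normSq (z + z'))
        = s * (Complex.normSq y' - Complex.normSq z')
          + t * (Complex.normSq x' - Complex.normSq z') := by
    intro x' y' z'
    have h1 := hb.1.form_add_ker hk (x' • a + y' • b + z' • c)
    have h2 : x • a + y • b + z • c + (x' • a + y' • b + z' • c)
        = (x + x') • a + (y + y') • b + (z + z') • c := by module
    rwa [h2, hst, hst, Complex.ofReal_inj] at h1
  have hst0 : s + t = 0 := by
    by_contra hne
    have h0 := hadd 0 0 0
    have hx1 := hadd x 0 0
    have hy1 := hadd 0 y 0
    have hz1 := hadd 0 0 z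
    simp only [add_zero, map_zero, sub_zero, ← two_mul, map_mul, Complex.normSq_ofNat]
      at h0 hx1 hy1 hz1
    have ex : t * Complex.normSq x = 0 := by linarith
    have ey : s * Complex.normSq y = 0 := by linarith
    have ez : (s + t) * Complex.normSq z = 0 := by linarith
    simp only [mul_eq_zero, Complex.normSq_eq_zero, hs, ht, hne, false_or] at ex ey ez
    simp [ex, ey, ez] at hk0
  refine ⟨s, hs, fun x y z => ?_⟩
  rw [hst, Complex.ofReal_inj]
  linear_combination (Complex.normSq x - Complex.normSq z) * hst0

/-- If the line through the two foci is a slice of the first bisector only, then no third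
bisector contains an open piece of the intersection. -/
lemma giraud_cylinder {h₁ h₂ : Module.End ℂ V3} {a b c : V3} {r₂ : ℝ} (hr₂ : r₂ ≠ 0)
    (hspan : ∀ v, ∃ x y z : ℂ, v = x • a + y • b + z • c)
    (hq₁ : ∀ x y z : ℂ, herm (h₁ (x • a + y • b + z • c)) (x • a + y • b + z • c)
      = ((2 * (y * conj z).re : ℝ) : ℂ))
    (hq₂ : ∀ x y z : ℂ, herm (h₂ (x • a + y • b + z • c)) (x • a + y • b + z • c)
      = ((r₂ * (Complex.normSq x - Complex.normSq z) : ℝ) : ℂ))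
    {N : Set V3} (hN : IsOpen N) (hne : ∃ v ∈ N, v ≠ 0 ∧ herm (h₁ v) v = 0 ∧ herm (h₂ v) v = 0)
    {h : Module.End ℂ V3} (hb : IsBisector h) (hne₁ : Bset h ≠ Bset h₁) (hne₂ : Bset h ≠ Bset h₂)
    (hvan : ∀ v ∈ N, herm (h₁ v) v = 0 → herm (h₂ v) v = 0 → herm (h v) v = 0) :
    False := by
  obtain ⟨x₀, y₀, z₀, hvN, hx, hy, hz₀⟩ : ∃ x₀ y₀ z₀ : ℂ, x₀ • a + y₀ • b + z₀ • c ∈ N ∧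
      Complex.normSq x₀ = Complex.normSq z₀ ∧ (y₀ * conj z₀).re = 0 ∧ z₀ ≠ 0 := by
    obtain ⟨v, hvN, hv0, h1v, h2v⟩ := hne
    obtain ⟨x₀, y₀, z₀, rfl⟩ := hspan v
    have hy : (y₀ * conj z₀).re = 0 := by
      rw [hq₁, Complex.ofReal_eq_zero] at h1v
      linarith
    have hx : Complex.normSq x₀ = Complex.normSq z₀ := by
      rw [hq₂, Complex.ofReal_eq_zero] at h2v
      exact sub_eq_zero.mp ((mul_eq_zero.mp h2v).resolve_left hr₂)
    by_cases hz₀ : z₀ = 0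
    · subst hz₀
      obtain rfl : x₀ = 0 := by simpa using hx
      have hy₀ : y₀ ≠ 0 := by rintro rfl; simp at hv0
      have hcont : Continuous fun t : ℝ =>
          (t * Complex.I * y₀) • a + y₀ • b + (t * Complex.I * y₀) • c := by fun_prop
      have hev : ∀ᶠ t : ℝ in 𝓝 0,
          (t * Complex.I * y₀) • a + y₀ • b + (t * Complex.I * y₀) • c ∈ N :=
        hcont.continuousAt.eventually (hN.mem_nhds (by simpa using hvN))
      obtain ⟨t, htN, ht⟩ := ((hev.filter_mono nhdsWithin_le_nhds).and
        (self_mem_nhdsWithin (a := (0 : ℝ)) (s := {0}ᶜ))).exists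
      have ht : t ≠ 0 := ht
      refine ⟨_, _, _, htN, rfl, ?_, ?_⟩
      · simp; ring
      · simp [ht, hy₀]
    · exact ⟨x₀, y₀, z₀, hvN, hx, hy, hz₀⟩
  obtain ⟨s, t, hst⟩ := hb.1.cylinder_rigidity hN hvN hx hy hz₀ fun x y z hm hxz hyz =>
    hvan _ hm (by rw [hq₁, hyz]; simp) (by rw [hq₂, hxz]; simp)
  have hs : s ≠ 0 := by
    rintro rfl
    refine hne₂ (Bset_eq_of_form_smul hb (s := t / r₂) fun v => ?_)
    obtain ⟨x, y, z, rfl⟩ := hspan v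
    rw [hst, hq₂, ← Complex.ofReal_mul]
    congr 1; field_simp; ring
  have ht : t ≠ 0 := by
    rintro rfl
    refine hne₁ (Bset_eq_of_form_smul hb (s := s / 2) fun v => ?_)
    obtain ⟨x, y, z, rfl⟩ := hspan v
    rw [hst, hq₁, ← Complex.ofReal_mul]
    congr 1; ring
  obtain ⟨k, hk0, hk, -⟩ := hb.exists_ker
  obtain ⟨x, y, z, rfl⟩ := hspan k
  have hadd : ∀ x' y' z' : ℂ,
      s * ((y + y') * conj (z + z')).re
          + t * (Complex.normSq (x + x') - Complex.normSq (z + z'))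
        = s * (y' * conj z').re + t * (Complex.normSq x' - Complex.normSq z') := by
    intro x' y' z'
    have h1 := hb.1.form_add_ker hk (x' • a + y' • b + z' • c)
    have h2 : x • a + y • b + z • c + (x' • a + y' • b + z' • c)
        = (x + x') • a + (y + y') • b + (z + z') • c := by module
    rwa [h2, hst, hst, Complex.ofReal_inj] at h1
  have h0 := hadd 0 0 0
  have hx1 := hadd x 0 0
  have hy1 := hadd 0 z 0
  have hz1 := hadd 0 0 y
  simp only [Complex.normSq_apply, Complex.add_re, Complex.add_im, Complex.mul_re,
    Complex.conj_re, Complex.conj_im, Complex.zero_re, Complex.zero_im] at h0 hx1 hy1 hz1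
  have ex : t * Complex.normSq x = 0 := by rw [Complex.normSq_apply]; linarith
  have ez : s * Complex.normSq z = 0 := by rw [Complex.normSq_apply]; linarith
  obtain rfl : x = 0 := by simpa [ht] using ex
  obtain rfl : z = 0 := by simpa [hs] using ez
  have ey : s * Complex.normSq y = 0 := by
    rw [Complex.normSq_apply]
    simp only [Complex.zero_re, Complex.zero_im] at hz1 h0
    linarith
  obtain rfl : y = 0 := by simpa [hs] using ey
  simp at hk0

/-- Two bisectors with distinct foci, extended to a basis by a third vector. -/
lemma exists_complement {f₁ f₂ : V3} (hi : LinearIndependent ℂ ![f₁, f₂]) :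
    ∃ w, (∀ v, ∃ x y z : ℂ, v = x • f₁ + y • f₂ + z • w) ∧
      ∀ x y : ℂ, w ≠ x • f₁ + y • f₂ := by
  obtain ⟨w, hw⟩ : ∃ w, w ∉ Submodule.span ℂ (Set.range ![f₁, f₂]) := by
    by_contra! hall
    have h1 := finrank_span_eq_card hi
    rw [(Submodule.eq_top_iff').mpr hall, finrank_top] at h1
    simp at h1
  have hi3 : LinearIndependent ℂ (Fin.cons w ![f₁, f₂] : Fin 3 → V3) :=
    linearIndependent_finCons.mpr ⟨hi, hw⟩
  refine ⟨w, fun v => ?_, fun x y hxy => hw ?_⟩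
  · set b := basisOfLinearIndependentOfCardEqFinrank hi3 (by simp) with hb
    refine ⟨b.repr v 1, b.repr v 2, b.repr v 0, ?_⟩
    conv_lhs => rw [← b.sum_repr v]
    simp [Fin.sum_univ_three, hb]
    abel
  · rw [Matrix.range_cons_cons_empty, hxy]
    exact Submodule.mem_span_pair.mpr ⟨x, y, rfl⟩

/-- If the line through the two foci is a slice of the first bisector, then no third
bisector contains an open piece of the intersection. -/
lemma giraud_of_slice {h₁ h₂ : Module.End ℂ V3} (hb₁ : IsBisector h₁) (hb₂ : IsBisector h₂)
    {f₁ f₂ w : V3} (h1f : h₁ f₁ = 0) (h2f : h₂ f₂ = 0) (h12 : h₁ f₂ ≠ 0)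
    (hker₂ : ∀ c : ℂ, h₂ (w + c • f₁) ≠ 0)
    (hspan : ∀ v, ∃ x y z : ℂ, v = x • f₁ + y • f₂ + z • w)
    (hα₁ : herm (h₁ f₂) f₂ = 0) (hα₂ : herm (h₂ f₁) f₁ ≠ 0)
    {N : Set V3} (hN : IsOpen N) (hne : ∃ v ∈ N, v ≠ 0 ∧ herm (h₁ v) v = 0 ∧ herm (h₂ v) v = 0)
    {h : Module.End ℂ V3} (hb : IsBisector h) (hne₁ : Bset h ≠ Bset h₁) (hne₂ : Bset h ≠ Bset h₂)
    (hvan : ∀ v ∈ N, herm (h₁ v) v = 0 → herm (h₂ v) v = 0 → herm (h v) v = 0) :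
    False := by
  obtain ⟨μ₂, c₂, hμ₂, hq₁⟩ := hb₁.exists_normal_form_of_slice h1f hspan h12 hα₁
  obtain ⟨μ₁, c₁, r₂, hμ₁, hr₂, hq₂⟩ := hb₂.exists_normal_form h2f
    (fun v => by
      obtain ⟨x, y, z, rfl⟩ := hspan v
      exact ⟨y, x, z, by abel⟩) hker₂ hα₂
  refine giraud_cylinder (h₁ := h₁) (h₂ := h₂) (a := μ₁ • f₁) (b := μ₂ • f₂)
    (c := w + c₁ • f₁ + c₂ • f₂) hr₂ (fun v => ?_) (fun x y z => ?_) (fun x y z => ?_)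
    hN hne hb hne₁ hne₂ hvan
  · obtain ⟨x, y, z, rfl⟩ := hspan v
    refine ⟨(x - z * c₁) / μ₁, (y - z * c₂) / μ₂, z, ?_⟩
    simp only [smul_smul, div_mul_cancel₀ _ hμ₁, div_mul_cancel₀ _ hμ₂]
    module
  · have hv : x • (μ₁ • f₁) + y • (μ₂ • f₂) + z • (w + c₁ • f₁ + c₂ • f₂)
        = (x * μ₁ + z * c₁) • f₁ + y • (μ₂ • f₂) + z • (w + c₂ • f₂) := by module
    rw [hv, hq₁]
  · have hv : x • (μ₁ • f₁) + y • (μ₂ • f₂) + z • (w + c₁ • f₁ + c₂ • f₂)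
        = (y * μ₂ + z * c₂) • f₂ + x • (μ₁ • f₁) + z • (w + c₁ • f₁) := by module
    rw [hv, hq₂]

/-- Giraud rigidity: two bisectors with no common slice and nonempty
intersection inside the ball admit at most one further bisector through an open piece
of the intersection, and such a bisector contains the whole intersection. -/
theorem stmt_4 (h₁ h₂ h₃ h₄ : Module.End ℂ V3)
    (hb₁ : IsBisector h₁) (hb₂ : IsBisector h₂) (hb₃ : IsBisector h₃) (hb₄ : IsBisector h₄)
    (hslice : ∀ U : Submodule ℂ V3, Module.finrank ℂ U = 2 →
      ¬ projC U ⊆ Bset h₁ ∩ Bset h₂)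
    (hD : ∃ v : V3, (herm v v).re < 0 ∧ herm (h₁ v) v = 0 ∧ herm (h₂ v) v = 0)
    (U : Set V3) (hU : IsOpen U)
    (hD' : ∃ v ∈ U, (herm v v).re < 0 ∧ herm (h₁ v) v = 0 ∧ herm (h₂ v) v = 0)
    (h3ne1 : Bset h₃ ≠ Bset h₁) (h3ne2 : Bset h₃ ≠ Bset h₂)
    (h4ne1 : Bset h₄ ≠ Bset h₁) (h4ne2 : Bset h₄ ≠ Bset h₂)
    (hh₃ : ∀ v ∈ U, (herm v v).re < 0 → herm (h₁ v) v = 0 → herm (h₂ v) v = 0 →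
      herm (h₃ v) v = 0)
    (hh₄ : ∀ v ∈ U, (herm v v).re < 0 → herm (h₁ v) v = 0 → herm (h₂ v) v = 0 →
      herm (h₄ v) v = 0) :
    Bset h₃ = Bset h₄ ∧ Bset h₁ ∩ Bset h₂ ⊆ Bset h₃ := by
  set N : Set V3 := U ∩ {v | (herm v v).re < 0}
  have hN : IsOpen N := isOpen_inter_neg hU
  have hne : ∃ v ∈ N, v ≠ 0 ∧ herm (h₁ v) v = 0 ∧ herm (h₂ v) v = 0 := by
    obtain ⟨v, hvU, hv, h1, h2⟩ := hD'
    exact ⟨v, ⟨hvU, hv⟩, fun h0 => by simp [h0, herm_zero_left] at hv, h1, h2⟩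
  have hv₃ : ∀ v ∈ N, herm (h₁ v) v = 0 → herm (h₂ v) v = 0 → herm (h₃ v) v = 0 :=
    fun v hv => hh₃ v hv.1 hv.2
  have hv₄ : ∀ v ∈ N, herm (h₁ v) v = 0 → herm (h₂ v) v = 0 → herm (h₄ v) v = 0 :=
    fun v hv => hh₄ v hv.1 hv.2
  have hns : ¬ ∃ W : Submodule ℂ V3, Module.finrank ℂ W = 2 ∧ projC W ⊆ Bset h₁ ∩ Bset h₂ :=
    fun ⟨W, hW, hsub⟩ => hslice W hW hsub
  obtain ⟨f₁, hf₁, h1f, hk₁⟩ := hb₁.exists_ker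
  obtain ⟨f₂, hf₂, h2f, hk₂⟩ := hb₂.exists_ker
  have h21 : h₂ f₁ ≠ 0 := fun h0 =>
    hns (exists_slice_of_common_focus hb₁ hb₂ hf₁ h1f h0 hD)
  have h12 : h₁ f₂ ≠ 0 := fun h0 =>
    hns (exists_slice_of_common_focus hb₁ hb₂ hf₂ h0 h2f hD)
  have hi : LinearIndependent ℂ ![f₁, f₂] := by
    rw [LinearIndependent.pair_iff' hf₁]
    rintro c rfl
    exact h12 (by rw [map_smul, h1f, smul_zero])
  obtain ⟨w, hspan, hw⟩ := exists_complement hi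
  have hker₁ : ∀ c : ℂ, h₁ (w + c • f₂) ≠ 0 := by
    intro c h0
    obtain ⟨d, hd⟩ := hk₁ _ h0
    exact hw d (-c) (by rw [hd]; module)
  have hker₂ : ∀ c : ℂ, h₂ (w + c • f₁) ≠ 0 := by
    intro c h0
    obtain ⟨d, hd⟩ := hk₂ _ h0
    exact hw (-c) d (by rw [hd]; module)
  have hspan' : ∀ v, ∃ x y z : ℂ, v = x • f₂ + y • f₁ + z • w := fun v => by
    obtain ⟨x, y, z, rfl⟩ := hspan v
    exact ⟨y, x, z, by abel⟩
  by_cases hα₁ : herm (h₁ f₂) f₂ = 0 <;> by_cases hα₂ : herm (h₂ f₁) f₁ = 0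
  · refine absurd (exists_slice hi fun x y => ⟨?_, ?_⟩) hns
    · rw [hb₁.1.form_expand_two]; simp [h1f, hα₁, herm_zero_left]
    · rw [hb₂.1.form_expand_two]; simp [hb₂.1.form_ker_right h2f, hα₂]
  · exact (giraud_of_slice hb₁ hb₂ h1f h2f h12 hker₂ hspan hα₁ hα₂ hN hne hb₃
      h3ne1 h3ne2 hv₃).elim
  · refine (giraud_of_slice hb₂ hb₁ h2f h1f h21 hker₁ hspan' hα₂ hα₁ hN ?_ hb₃
      h3ne2 h3ne1 fun v hv h2 h1 => hv₃ v hv h1 h2).elim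
    obtain ⟨v, hv, h0, h1, h2⟩ := hne
    exact ⟨v, hv, h0, h2, h1⟩
  obtain ⟨μ₂, c₂, r₁, hμ₂, hr₁, hq₁⟩ := hb₁.exists_normal_form h1f hspan hker₁ hα₁
  obtain ⟨μ₁, c₁, r₂, hμ₁, hr₂, hq₂⟩ := hb₂.exists_normal_form h2f hspan' hker₂ hα₂
  set a := μ₁ • f₁ with ha
  set b := μ₂ • f₂ with hb
  set c := w + c₁ • f₁ + c₂ • f₂ with hc
  have hq₁' : ∀ x y z : ℂ, herm (h₁ (x • a + y • b + z • c)) (x • a + y • b + z • c)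
      = ((r₁ * (Complex.normSq y - Complex.normSq z) : ℝ) : ℂ) := fun x y z => by
    have hv : x • (μ₁ • f₁) + y • (μ₂ • f₂) + z • (w + c₁ • f₁ + c₂ • f₂)
        = (x * μ₁ + z * c₁) • f₁ + y • (μ₂ • f₂) + z • (w + c₂ • f₂) := by module
    rw [ha, hb, hc, hv, hq₁]
  have hq₂' : ∀ x y z : ℂ, herm (h₂ (x • a + y • b + z • c)) (x • a + y • b + z • c)
      = ((r₂ * (Complex.normSq x - Complex.normSq z) : ℝ) : ℂ) := fun x y z => by
    have hv : x • (μ₁ • f₁) + y • (μ₂ • f₂) + z • (w + c₁ • f₁ + c₂ • f₂)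
        = (y * μ₂ + z * c₂) • f₂ + x • (μ₁ • f₁) + z • (w + c₁ • f₁) := by module
    rw [ha, hb, hc, hv, hq₂]
  have hspanb : ∀ v, ∃ x y z : ℂ, v = x • a + y • b + z • c := fun v => by
    obtain ⟨x, y, z, rfl⟩ := hspan v
    refine ⟨(x - z * c₁) / μ₁, (y - z * c₂) / μ₂, z, ?_⟩
    simp only [ha, hb, smul_smul, div_mul_cancel₀ _ hμ₁, div_mul_cancel₀ _ hμ₂]
    module
  obtain ⟨s, hs, h3⟩ := giraud_torus hr₁ hr₂ hspanb hq₁' hq₂' hN hne hb₃ h3ne1 h3ne2 hv₃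
  obtain ⟨t, ht, h4⟩ := giraud_torus hr₁ hr₂ hspanb hq₁' hq₂' hN hne hb₄ h4ne1 h4ne2 hv₄
  refine ⟨Bset_congr fun v => ?_, ?_⟩
  · obtain ⟨x, y, z, rfl⟩ := hspanb v
    rw [h3, h4]
    simp [hs, ht]
  · rintro p ⟨⟨v, hv, rfl, h1v⟩, h2p⟩
    have h2v := (projMk_mem_Bset hv).mp h2p
    rw [projMk_mem_Bset hv]
    obtain ⟨x, y, z, rfl⟩ := hspanb v
    rw [hq₁', Complex.ofReal_eq_zero, mul_eq_zero, or_iff_right hr₁] at h1v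
    rw [hq₂', Complex.ofReal_eq_zero, mul_eq_zero, or_iff_right hr₂] at h2v
    rw [h3, Complex.ofReal_eq_zero]
    linear_combination s * (h1v - h2v)

end
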